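/- Collapse identity: for every integer n ≥ 0 and every f ∈ 𝒫_Y, Θ_Z̃( Z̃_+( Λ_Z̃^{n}( Δ( z_0·f ) ) ) ) = (1+b)·Y_+( Λ_Y^{n} f ); i.e. the operators Θ_Z̃ Z̃_+ Λ_Z̃^{n} Δ (z_0·) and (1+b)·Y_+Λ_Y^{n} coincide on 𝒫_Y. -/

import Mathlib

open MvPolynomial

noncomputable section

/-- The base field `K = ℚ(b)`: rational functions in an indeterminate `b` over `ℚ`. -/
abbrev K : Type := RatFunc ℚ

/-- The indeterminate `b ∈ K`. -/
def bb : K := RatFunc.X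

/-- `α = 1 + b`. -/
def alpha : K := 1 + bb

/-- Variables: `p i` (used for `i ≥ 1`) and `y i`, `y' i`, `z i`, `z' i` (`i ≥ 0`). -/
inductive Var : Type
  | p : ℕ → Var
  | y : ℕ → Var
  | y' : ℕ → Var
  | z : ℕ → Var
  | z' : ℕ → Var
  deriving DecidableEq

/-- The ambient polynomial ring `R′`. -/
abbrev R : Type := MvPolynomial Var K

/-- The generic operator
`Λ_A = α Σ_{i,j≥1} i a_{i+j−1} ∂²/∂p_i∂a_{j−1} + Σ_{i,j≥1} a_{i−1} p_j ∂/∂a_{i+j−1}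
     + b Σ_{i≥1} i a_i ∂/∂a_i` for the alphabet `a ∈ {y, y′, z, z′}`. -/
def Lam (a : ℕ → Var) (f : R) : R :=
  alpha • (∑ᶠ (i : ℕ) (j : ℕ), ((i + 1 : ℕ) : K) •
      (X (a (i + j + 1)) * pderiv (Var.p (i + 1)) (pderiv (a j) f)))
    + (∑ᶠ (i : ℕ) (j : ℕ), X (a i) * X (Var.p (j + 1)) * pderiv (a (i + j + 1)) f)
    + bb • (∑ᶠ (i : ℕ), ((i + 1 : ℕ) : K) • (X (a (i + 1)) * pderiv (a (i + 1)) f))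

/-- The generic shift operator `A_+ = Σ_{i≥0} a_{i+1} ∂/∂a_i`. -/
def Plus (a : ℕ → Var) (f : R) : R := ∑ᶠ (i : ℕ), X (a (i + 1)) * pderiv (a i) f

/-- The generic operator `Θ_A = Σ_{i≥1} p_i ∂/∂a_i`. -/
def Theta (a : ℕ → Var) (f : R) : R := ∑ᶠ (i : ℕ), X (Var.p (i + 1)) * pderiv (a (i + 1)) f

/-- `M_Z = α Σ_{i,j,k≥1} y′_{i+j−1} z′_{k−1} ∂²/∂y_{i+k−1}∂z_{j−1}
         + Σ_{i,j,k≥1} y_{i+j−1} z_{k−1} ∂²/∂y′_{i+k−1}∂z′_{j−1}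
         + b Σ_{i,j,k≥1} y′_{i+j−1} z′_{k−1} ∂²/∂y′_{i+k−1}∂z′_{j−1}`. -/
def MZ (f : R) : R :=
  alpha • (∑ᶠ (i : ℕ) (j : ℕ) (k : ℕ), X (Var.y' (i + j + 1)) * X (Var.z' k) *
      pderiv (Var.y (i + k + 1)) (pderiv (Var.z j) f))
    + (∑ᶠ (i : ℕ) (j : ℕ) (k : ℕ), X (Var.y (i + j + 1)) * X (Var.z k) *
      pderiv (Var.y' (i + k + 1)) (pderiv (Var.z' j) f))
    + bb • (∑ᶠ (i : ℕ) (j : ℕ) (k : ℕ), X (Var.y' (i + j + 1)) * X (Var.z' k) *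
      pderiv (Var.y' (i + k + 1)) (pderiv (Var.z' j) f))

/-- `M_Y`: obtained from `M_Z` by exchanging `y ↔ z` and `y′ ↔ z′` everywhere. -/
def MY (f : R) : R :=
  alpha • (∑ᶠ (i : ℕ) (j : ℕ) (k : ℕ), X (Var.z' (i + j + 1)) * X (Var.y' k) *
      pderiv (Var.z (i + k + 1)) (pderiv (Var.y j) f))
    + (∑ᶠ (i : ℕ) (j : ℕ) (k : ℕ), X (Var.z (i + j + 1)) * X (Var.y k) *
      pderiv (Var.z' (i + k + 1)) (pderiv (Var.y' j) f))
    + bb • (∑ᶠ (i : ℕ) (j : ℕ) (k : ℕ), X (Var.z' (i + j + 1)) * X (Var.y' k) *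
      pderiv (Var.z' (i + k + 1)) (pderiv (Var.y' j) f))

/-- `Λ_Ỹ = Λ_Y + Λ_{Y′} + M_Y`. -/
def LamYt (f : R) : R := Lam Var.y f + Lam Var.y' f + MY f

/-- `Λ_Z̃ = Λ_Z + Λ_{Z′} + M_Z`. -/
def LamZt (f : R) : R := Lam Var.z f + Lam Var.z' f + MZ f

/-- `Ỹ_+ = Y_+ + Y′_+`. -/
def Ytplus (f : R) : R := Plus Var.y f + Plus Var.y' f

/-- `Z̃_+ = Z_+ + Z′_+`. -/
def Ztplus (f : R) : R := Plus Var.z f + Plus Var.z' f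

/-- `Θ_Z̃ = ∂/∂z₀ + Σ_{i≥1} p_i ∂/∂z_i + Σ_{i,j≥0} y_{i+j} ∂²/∂y′_i∂z′_j`. -/
def ThZt (f : R) : R :=
  pderiv (Var.z 0) f + (∑ᶠ (i : ℕ), X (Var.p (i + 1)) * pderiv (Var.z (i + 1)) f)
    + (∑ᶠ (i : ℕ) (j : ℕ), X (Var.y (i + j)) * pderiv (Var.y' i) (pderiv (Var.z' j) f))

/-- `Θ_Ỹ = ∂/∂y₀ + Σ_{i≥1} p_i ∂/∂y_i + Σ_{i,j≥0} z_{i+j} ∂²/∂z′_i∂y′_j`. -/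
def ThYt (f : R) : R :=
  pderiv (Var.y 0) f + (∑ᶠ (i : ℕ), X (Var.p (i + 1)) * pderiv (Var.y (i + 1)) f)
    + (∑ᶠ (i : ℕ) (j : ℕ), X (Var.z (i + j)) * pderiv (Var.z' i) (pderiv (Var.y' j) f))

/-- `Δ = α Σ_{i,j≥0} z′_i y′_j ∂²/∂y_i∂z_j + Σ_{i,j≥0} z_i y_j ∂²/∂y′_i∂z′_j
      + b Σ_{i,j≥0} z′_i y′_j ∂²/∂y′_i∂z′_j`. -/
def Delta (f : R) : R :=
  alpha • (∑ᶠ (i : ℕ) (j : ℕ), X (Var.z' i) * X (Var.y' j) *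
      pderiv (Var.y i) (pderiv (Var.z j) f))
    + (∑ᶠ (i : ℕ) (j : ℕ), X (Var.z i) * X (Var.y j) *
      pderiv (Var.y' i) (pderiv (Var.z' j) f))
    + bb • (∑ᶠ (i : ℕ) (j : ℕ), X (Var.z' i) * X (Var.y' j) *
      pderiv (Var.y' i) (pderiv (Var.z' j) f))

/-- `𝒫`: the subalgebra of polynomials in the `p`-variables only. -/
def Psub : Subalgebra K R := MvPolynomial.supported K (Set.range Var.p)

/-- `𝒫_Y`: the `K`-linear span of the monomials `p_λ` and `y_i·p_λ`. -/
def PY : Submodule K R :=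
  Submodule.span K ((Psub : Set R) ∪
    {g : R | ∃ i : ℕ, ∃ f ∈ (Psub : Set R), g = X (Var.y i) * f})

/-- `𝒫_{Ỹ,Z̃}`: the `K`-linear span of the monomials
`p_λ, y_i·p_λ, z_j·p_λ, y_i·z_j·p_λ, y′_i·p_λ, z′_j·p_λ, y′_i·z′_j·p_λ`. -/
def PYZt : Submodule K R :=
  Submodule.span K ((Psub : Set R) ∪
    {g : R | ∃ f ∈ (Psub : Set R),
      (∃ i : ℕ, g = X (Var.y i) * f) ∨ (∃ j : ℕ, g = X (Var.z j) * f) ∨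
      (∃ i : ℕ, ∃ j : ℕ, g = X (Var.y i) * X (Var.z j) * f) ∨
      (∃ i : ℕ, g = X (Var.y' i) * f) ∨ (∃ j : ℕ, g = X (Var.z' j) * f) ∨
      (∃ i : ℕ, ∃ j : ℕ, g = X (Var.y' i) * X (Var.z' j) * f)})

/-- The `K`-linear span of the polynomials `y_i·g` with `g ∈ 𝒫`. -/
def YPart : Submodule K R :=
  Submodule.span K {g : R | ∃ i : ℕ, ∃ f ∈ (Psub : Set R), g = X (Var.y i) * f}

/-- The involution of the variables exchanging `y` and `z′`. -/
def swapYZ' : Var → Var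
  | .p i => .p i
  | .y i => .z' i
  | .y' i => .y' i
  | .z i => .z i
  | .z' i => .y i

lemma swapYZ'_injective : Function.Injective swapYZ' := by
  have h : Function.Involutive swapYZ' := by rintro (_ | _ | _ | _ | _) <;> rfl
  exact h.injective

lemma alpha_ne_zero : alpha ≠ 0 := by
  have h : (1 + Polynomial.X : Polynomial ℚ) ≠ 0 := by
    rw [add_comm]
    exact Polynomial.X_add_C_ne_zero 1
  have h' := (map_ne_zero_iff (algebraMap (Polynomial ℚ) K) (RatFunc.algebraMap_injective ℚ)).2 h
  simpa [alpha, bb] using h'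

lemma pderiv_pderiv_comm (u v : Var) (f : R) :
    pderiv u (pderiv v f) = pderiv v (pderiv u f) := by
  have h : ⁅(pderiv u : Derivation K R R), (pderiv v : Derivation K R R)⁆ = 0 := by
    refine MvPolynomial.derivation_ext fun w => ?_
    by_cases hu : w = u <;> by_cases hv : w = v <;>
      simp [Derivation.commutator_apply, pderiv_X, Pi.single_apply, hu, hv, apply_ite]
  have := congrArg (fun D : Derivation K R R => D f) h
  simpa [Derivation.commutator_apply, sub_eq_zero] using this

lemma pderiv_mem_Psub {g : R} (hg : g ∈ Psub) (i : ℕ) : pderiv (Var.p i) g ∈ Psub := by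
  have hX : ∀ j, (X (Var.p j) : R) ∈ Psub := fun j =>
    Algebra.subset_adjoin ⟨_, ⟨j, rfl⟩, rfl⟩
  unfold Psub supported at hg
  induction hg using Algebra.adjoin_induction with
  | mem x hx =>
    obtain ⟨_, ⟨j, rfl⟩, rfl⟩ := hx
    by_cases h : j = i
    · subst h; simp
    · rw [pderiv_X_of_ne (by simpa using h)]
      exact zero_mem _
  | algebraMap r => simp [MvPolynomial.algebraMap_eq, zero_mem]
  | add x y _ _ hx hy => simpa using add_mem hx hy
  | mul x y hx' hy' hx hy =>
    rw [pderiv_mul]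
    exact add_mem (mul_mem hx hy') (mul_mem hx' hy)

lemma pderiv_eq_zero_of_mem_Psub {g : R} (hg : g ∈ Psub) {v : Var} (hv : v ∉ Set.range Var.p) :
    pderiv v g = 0 :=
  pderiv_eq_zero_of_notMem_vars fun h => hv (mem_supported.1 hg h)

lemma YPart_le_PY : YPart ≤ PY := Submodule.span_mono Set.subset_union_right

lemma exists_add_of_mem_PY {f : R} (hf : f ∈ PY) : ∃ g ∈ Psub, ∃ h ∈ YPart, g + h = f := by
  rw [PY, Submodule.span_union, Submodule.mem_sup] at hf
  obtain ⟨g, hg, h, hh, rfl⟩ := hf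
  refine ⟨g, ?_, h, hh, rfl⟩
  have : Submodule.span K (Psub : Set R) = Subalgebra.toSubmodule Psub :=
    Submodule.span_eq (Subalgebra.toSubmodule Psub)
  rwa [this] at hg

lemma pderiv_y_mem_Psub_of_mem_YPart {f : R} (hf : f ∈ YPart) (i : ℕ) :
    pderiv (Var.y i) f ∈ Psub := by
  induction hf using Submodule.span_induction with
  | mem x hx =>
    obtain ⟨j, g, hg, rfl⟩ := hx
    rw [pderiv_mul, pderiv_eq_zero_of_mem_Psub hg (by simp), mul_zero, add_zero]
    by_cases h : j = i
    · subst h; simpa using hg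
    · rw [pderiv_X_of_ne (by simpa using h), zero_mul]
      exact zero_mem _
  | zero => simp [zero_mem]
  | add x y _ _ hx hy => simpa using add_mem hx hy
  | smul c x _ hx => simpa using Psub.smul_mem hx c

lemma pderiv_eq_zero_of_mem_YPart {f : R} (hf : f ∈ YPart) {v : Var}
    (hp : v ∉ Set.range Var.p) (hy : v ∉ Set.range Var.y) : pderiv v f = 0 := by
  induction hf using Submodule.span_induction with
  | mem x hx =>
    obtain ⟨j, g, hg, rfl⟩ := hx
    rw [pderiv_mul, pderiv_eq_zero_of_mem_Psub hg hp, pderiv_X_of_ne fun h => hy ⟨j, h⟩]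
    simp
  | zero => simp
  | add x y _ _ hx hy => simp [hx, hy]
  | smul c x _ hx => simp [hx]

lemma pderiv_eq_zero_of_mem_PY {f : R} (hf : f ∈ PY) {v : Var}
    (hp : v ∉ Set.range Var.p) (hy : v ∉ Set.range Var.y) : pderiv v f = 0 := by
  obtain ⟨g, hg, h, hh, rfl⟩ := exists_add_of_mem_PY hf
  rw [map_add, pderiv_eq_zero_of_mem_Psub hg hp, pderiv_eq_zero_of_mem_YPart hh hp hy, add_zero]

lemma X_y_mul_mem_YPart {g : R} (hg : g ∈ Psub) (i : ℕ) : X (Var.y i) * g ∈ YPart :=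
  Submodule.subset_span ⟨i, g, hg, rfl⟩

lemma finsum_mem_submodule {ι : Type*} (S : Submodule K R) {u : ι → R} (h : ∀ i, u i ∈ S) :
    ∑ᶠ i, u i ∈ S :=
  finsum_induction (· ∈ S) S.zero_mem (fun _ _ => S.add_mem) h

lemma Lam_y_mem_YPart {f : R} (hf : f ∈ YPart) : Lam Var.y f ∈ YPart := by
  have hd := pderiv_y_mem_Psub_of_mem_YPart hf
  refine add_mem (add_mem (YPart.smul_mem _ ?_) ?_) (YPart.smul_mem _ ?_)
  · exact finsum_mem_submodule _ fun i => finsum_mem_submodule _ fun j => YPart.smul_mem _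
      (X_y_mul_mem_YPart (pderiv_mem_Psub (hd _) _) _)
  · refine finsum_mem_submodule _ fun i => finsum_mem_submodule _ fun j => ?_
    rw [mul_assoc]
    exact X_y_mul_mem_YPart (mul_mem (Algebra.subset_adjoin ⟨_, ⟨_, rfl⟩, rfl⟩) (hd _)) _
  · exact finsum_mem_submodule _ fun i => YPart.smul_mem _ (X_y_mul_mem_YPart (hd _) _)

lemma Plus_y_mem_YPart {f : R} (hf : f ∈ YPart) : Plus Var.y f ∈ YPart :=
  finsum_mem_submodule _ fun _ =>
    X_y_mul_mem_YPart (pderiv_y_mem_Psub_of_mem_YPart hf _) _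

lemma Lam_congr {a : ℕ → Var} {f g : R} (h : ∀ i, pderiv (a i) f = pderiv (a i) g) :
    Lam a f = Lam a g := by
  simp only [Lam, h]

lemma Plus_congr {a : ℕ → Var} {f g : R} (h : ∀ i, pderiv (a i) f = pderiv (a i) g) :
    Plus a f = Plus a g := by
  simp only [Plus, h]

lemma Lam_eq_zero {a : ℕ → Var} {f : R} (h : ∀ i, pderiv (a i) f = 0) : Lam a f = 0 := by
  simp [Lam, h]

lemma Plus_eq_zero {a : ℕ → Var} {f : R} (h : ∀ i, pderiv (a i) f = 0) : Plus a f = 0 := by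
  simp [Plus, h]

/-- On polynomials of degree one in the `y`-variables the Euler operator is the identity. -/
lemma finsum_X_mul_pderiv_y {f : R} (hf : f ∈ YPart) :
    ∑ᶠ i : ℕ, X (Var.y i) * pderiv (Var.y i) f = f := by
  have fin : ∀ g : R, (fun i : ℕ => X (Var.y i) * pderiv (Var.y i) g).HasFiniteSupport := by
    intro g
    have hinj : Function.Injective Var.y := fun _ _ h => Var.y.inj h
    refine (g.vars.finite_toSet.preimage hinj.injOn).subset fun i hi => ?_
    by_contra h
    exact hi (by simp [pderiv_eq_zero_of_notMem_vars (show Var.y i ∉ g.vars from h)])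
  induction hf using Submodule.span_induction with
  | mem x hx =>
    obtain ⟨j, g, hg, rfl⟩ := hx
    rw [finsum_eq_single _ j fun i hi => ?_]
    · rw [pderiv_mul, pderiv_eq_zero_of_mem_Psub hg (by simp)]
      simp
    · rw [pderiv_mul, pderiv_eq_zero_of_mem_Psub hg (by simp),
        pderiv_X_of_ne (by simpa using Ne.symm hi)]
      simp
  | zero => simp
  | add x y _ _ hx hy =>
    simp only [map_add, mul_add]
    rw [finsum_add_distrib (fin x) (fin y), hx, hy]
  | smul c x _ hx =>
    simp only [Derivation.map_smul, mul_smul_comm]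
    rw [← smul_finsum, hx]

/-- The map `y_i·g ↦ α·y′_0·z′_i·g`, which intertwines `Λ_Y` with `Λ_Z̃`. -/
def transfer : R →ₗ[K] R :=
  alpha • (LinearMap.mulLeft K (X (Var.y' 0))) ∘ₗ (rename swapYZ').toLinearMap

lemma transfer_apply (f : R) :
    transfer f = alpha • (X (Var.y' 0) * rename swapYZ' f) := rfl

lemma transfer_injective : Function.Injective transfer := by
  intro f g h
  simp only [transfer_apply] at h
  exact rename_injective _ swapYZ'_injective
    (mul_left_cancel₀ (X_ne_zero _) (smul_right_injective R alpha_ne_zero h))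

lemma transfer_finsum {ι : Sort*} (u : ι → R) : transfer (∑ᶠ i, u i) = ∑ᶠ i, transfer (u i) :=
  transfer.toAddMonoidHom.map_finsum_of_injective transfer_injective u

lemma transfer_X_mul (v : Var) (f : R) :
    transfer (X v * f) = X (swapYZ' v) * transfer f := by
  simp only [transfer_apply, map_mul, rename_X, mul_smul_comm]
  rw [mul_left_comm]

lemma pderiv_transfer {v : Var} (hv : swapYZ' v ≠ Var.y' 0) (f : R) :
    pderiv (swapYZ' v) (transfer f) = transfer (pderiv v f) := by
  rw [transfer_apply, transfer_apply, Derivation.map_smul, pderiv_mul, pderiv_X_of_ne hv.symm,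
    pderiv_rename swapYZ'_injective]
  simp

lemma pderiv_z'_transfer (i : ℕ) (f : R) :
    pderiv (Var.z' i) (transfer f) = transfer (pderiv (Var.y i) f) :=
  pderiv_transfer (v := .y i) (by simp [swapYZ']) f

lemma pderiv_p_transfer (i : ℕ) (f : R) :
    pderiv (Var.p i) (transfer f) = transfer (pderiv (Var.p i) f) :=
  pderiv_transfer (v := .p i) (by simp [swapYZ']) f

lemma pderiv_z_transfer {f : R} (hf : f ∈ YPart) (i : ℕ) :
    pderiv (Var.z i) (transfer f) = 0 := by
  rw [show Var.z i = swapYZ' (.z i) from rfl, pderiv_transfer (by simp [swapYZ']),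
    pderiv_eq_zero_of_mem_YPart hf (by simp) (by simp), map_zero]

lemma pderiv_y'_succ_transfer {f : R} (hf : f ∈ PY) (i : ℕ) :
    pderiv (Var.y' (i + 1)) (transfer f) = 0 := by
  rw [show Var.y' (i + 1) = swapYZ' (.y' (i + 1)) from rfl, pderiv_transfer (by simp [swapYZ']),
    pderiv_eq_zero_of_mem_PY hf (by simp) (by simp), map_zero]

lemma Lam_z'_transfer (f : R) : Lam Var.z' (transfer f) = transfer (Lam Var.y f) := by
  simp only [Lam, map_add, map_smul, transfer_finsum, pderiv_z'_transfer, pderiv_p_transfer,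
    mul_assoc, transfer_X_mul, swapYZ']

lemma Plus_z'_transfer (f : R) : Plus Var.z' (transfer f) = transfer (Plus Var.y f) := by
  simp only [Plus, transfer_finsum, pderiv_z'_transfer, transfer_X_mul, swapYZ']

lemma MZ_transfer {f : R} (hf : f ∈ YPart) : MZ (transfer f) = 0 := by
  have h : ∀ i j, pderiv (Var.y' (i + 1)) (pderiv (Var.z' j) (transfer f)) = 0 := fun i j => by
    rw [pderiv_pderiv_comm, pderiv_y'_succ_transfer (YPart_le_PY hf), map_zero]
  simp [MZ, h, pderiv_z_transfer hf]

lemma LamZt_transfer {f : R} (hf : f ∈ YPart) :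
    LamZt (transfer f) = transfer (Lam Var.y f) := by
  rw [LamZt, Lam_eq_zero (pderiv_z_transfer hf), MZ_transfer hf, Lam_z'_transfer, zero_add,
    add_zero]

lemma Ztplus_transfer {f : R} (hf : f ∈ YPart) :
    Ztplus (transfer f) = transfer (Plus Var.y f) := by
  rw [Ztplus, Plus_eq_zero (pderiv_z_transfer hf), Plus_z'_transfer, zero_add]

lemma rename_swapYZ'_of_mem_Psub {g : R} (hg : g ∈ Psub) : rename swapYZ' g = g := by
  unfold Psub supported at hg
  induction hg using Algebra.adjoin_induction with
  | mem x hx =>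
    obtain ⟨_, ⟨j, rfl⟩, rfl⟩ := hx
    simp [swapYZ']
  | algebraMap r => simp [MvPolynomial.algebraMap_eq]
  | add x y _ _ hx hy => simp [hx, hy]
  | mul x y _ _ hx hy => simp [hx, hy]

lemma pderiv_y'_zero_transfer_of_mem_Psub {g : R} (hg : g ∈ Psub) :
    pderiv (Var.y' 0) (transfer g) = alpha • g := by
  rw [transfer_apply, rename_swapYZ'_of_mem_Psub hg, Derivation.map_smul, pderiv_mul, pderiv_eq_zero_of_mem_Psub hg (by simp)]
  simp

lemma Psub_le_PY {g : R} (hg : g ∈ Psub) : g ∈ PY := Submodule.subset_span (Or.inl hg)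

lemma ThZt_transfer {f : R} (hf : f ∈ YPart) : ThZt (transfer f) = alpha • f := by
  have h : ∀ i, ∑ᶠ j : ℕ, X (Var.y (i + j)) *
      pderiv (Var.y' i) (pderiv (Var.z' j) (transfer f)) = if i = 0 then alpha • f else 0 := by
    rintro (_ | i)
    · simp only [pderiv_z'_transfer, zero_add, if_true, mul_smul_comm,
        pderiv_y'_zero_transfer_of_mem_Psub (pderiv_y_mem_Psub_of_mem_YPart hf _)]
      rw [← smul_finsum, finsum_X_mul_pderiv_y hf]
    · simp [pderiv_z'_transfer,
        pderiv_y'_succ_transfer (Psub_le_PY (pderiv_y_mem_Psub_of_mem_YPart hf _))]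
  simp only [ThZt, pderiv_z_transfer hf, h]
  rw [finsum_eq_single _ 0 fun i hi => if_neg hi]
  simp

lemma Delta_X_z_zero_mul {g h : R} (hg : g ∈ Psub) (hh : h ∈ YPart) :
    Delta (X (Var.z 0) * (g + h)) = transfer h := by
  have hf : g + h ∈ PY := add_mem (Psub_le_PY hg) (YPart_le_PY hh)
  have hz' : ∀ j, pderiv (Var.z' j) (X (Var.z 0) * (g + h)) = 0 := fun j => by
    rw [pderiv_mul, pderiv_eq_zero_of_mem_PY hf (by simp) (by simp), pderiv_X_of_ne (by simp)]
    simp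
  have hz : ∀ j, pderiv (Var.z j) (X (Var.z 0) * (g + h)) = if j = 0 then g + h else 0 := by
    rintro (_ | j)
    · rw [pderiv_mul, pderiv_eq_zero_of_mem_PY hf (by simp) (by simp)]
      simp
    · rw [pderiv_mul, pderiv_eq_zero_of_mem_PY hf (by simp) (by simp), pderiv_X_of_ne (by simp)]
      simp
  have hs : ∀ i, alpha • ∑ᶠ j : ℕ, X (Var.z' i) * X (Var.y' j) *
      pderiv (Var.y i) (pderiv (Var.z j) (X (Var.z 0) * (g + h)))
        = transfer (X (Var.y i) * pderiv (Var.y i) h) := by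
    intro i
    rw [finsum_eq_single _ 0 fun j hj => by simp [hz, hj]]
    rw [hz, if_pos rfl, map_add, pderiv_eq_zero_of_mem_Psub hg (by simp), zero_add,
      transfer_X_mul, transfer_apply,
      rename_swapYZ'_of_mem_Psub (pderiv_y_mem_Psub_of_mem_YPart hh i), mul_smul_comm, mul_assoc]
    rfl
  rw [Delta, smul_finsum]
  simp only [hs, hz', map_zero, mul_zero, finsum_zero, smul_zero, add_zero]
  rw [← transfer_finsum, finsum_X_mul_pderiv_y hh]

/-- **Collapse identity** (used in the proof of Lemma 4.9 of Chapuy–Dołęga): for every `n ≥ 0`,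
`Θ_Z̃ Z̃_+ Λ_Z̃^{n} Δ (z₀·) = (1+b)·Y_+Λ_Y^{n}` on `𝒫_Y`. -/
theorem collapse_identity (n : ℕ) :
    ∀ f ∈ PY,
      ThZt (Ztplus (LamZt^[n] (Delta (X (Var.z 0) * f))))
        = (1 + bb) • Plus Var.y ((Lam Var.y)^[n] f) := by
  intro f hf
  obtain ⟨g, hg, h, hh, rfl⟩ := exists_add_of_mem_PY hf
  have hy : ∀ i, pderiv (Var.y i) (g + h) = pderiv (Var.y i) h := fun i => by
    rw [map_add, pderiv_eq_zero_of_mem_Psub hg (by simp), zero_add]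
  have hP : Plus Var.y ((Lam Var.y)^[n] (g + h)) = Plus Var.y ((Lam Var.y)^[n] h) := by
    cases n with
    | zero => exact Plus_congr hy
    | succ n => rw [Function.iterate_succ_apply, Function.iterate_succ_apply, Lam_congr hy]
  have hmem : ∀ m, (Lam Var.y)^[m] h ∈ YPart := fun m => by
    induction m with
    | zero => exact hh
    | succ m ih => rw [Function.iterate_succ_apply']; exact Lam_y_mem_YPart ih
  have hiter : ∀ m, LamZt^[m] (transfer h) = transfer ((Lam Var.y)^[m] h) := fun m => by
    induction m with
    | zero => rfl
    | succ m ih =>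
      rw [Function.iterate_succ_apply', Function.iterate_succ_apply', ih, LamZt_transfer (hmem m)]
  rw [hP, Delta_X_z_zero_mul hg hh, hiter, Ztplus_transfer (hmem n),
    ThZt_transfer (Plus_y_mem_YPart (hmem n))]
  rfl
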